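/- arXiv:1511.08248 — 2 statements merged into one kernel-verified Lean document; each statement's English description precedes it below -/
import Mathlib

section
/- Let d ≥ 0, n ≥ 0, δ ∈ {0,…,n} be integers, let ξ be real, and let t_j, …, t_{j+d+1} be real numbers. Then Σ_{α ∈ ℕ^{d+2}, |α| = δ} (t_j + ξ)^{α_0} ⋯ (t_{j+d+1} + ξ)^{α_{d+1}} = Σ_{β = 0}^{δ} binom(δ + d + 1, β) ξ^β Σ_{a ∈ ℕ^{d+2}, |a| = δ − β} t_j^{a_0} ⋯ t_{j+d+1}^{a_{d+1}}. Consequently, if M_ξ denotes the reproduction matrix for the shifted knot sequence t_{0:T} + ξ and M := M_{0,t,γ}, then M_ξ = P_{d,n}(ξ) · M, where P_{d,n}(ξ) is the (n+1)×(n+1) lower-triangular matrix with entries P(δ,β) = binom(δ + d + 1, δ − β) ξ^{δ−β} for 0 ≤ β ≤ δ ≤ n and 0 otherwise. -/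
/-- Divided difference `[t_i, …, t_j] g` (confluent when the endpoints coincide):
`[t_i]g = g(t_i)`; for `j > i`, `[t_{i:j}]g = ([t_{i+1:j}]g − [t_{i:j−1}]g)/(t_j − t_i)`
if `t_i ≠ t_j`, and `[t_{i:j}]g = g^{(j−i)}(t_i)/(j−i)!` if `t_i = t_j`. -/
noncomputable def divDiff (g : ℝ → ℝ) (t : ℕ → ℝ) : ℕ → ℕ → ℝ
  | i, j =>
    if _h : j ≤ i then g (t i)
    else if t i = t j then iteratedDeriv (j - i) g (t i) / (j - i).factorial
    else (divDiff g t (i + 1) j - divDiff g t i (j - 1)) / (t j - t i)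
termination_by i j => j - i
decreasing_by all_goals omega

/-- B-spline of degree `d` with knot sequence `τ 0 ≤ τ 1 ≤ … ≤ τ (d+1)`:
`B(x|τ) = (τ_{d+1} − τ_0)·[τ_{0:d+1}](max(· − x, 0))^d`. -/
noncomputable def Bspline (d : ℕ) (τ : ℕ → ℝ) (x : ℝ) : ℝ :=
  (τ (d + 1) - τ 0) * divDiff (fun s => (max (s - x) 0) ^ d) τ 0 (d + 1)

/-- The reproduction matrix `M_{0,t,γ}` with entries
`M(δ,k) = [t_{γ k : γ k + d + 1}] x^{d+1+δ}`. -/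
noncomputable def reproMatrix (d n : ℕ) (γ : Fin (n + 1) → ℕ) (t : ℕ → ℝ) :
    Matrix (Fin (n + 1)) (Fin (n + 1)) ℝ :=
  Matrix.of fun δ k => divDiff (fun x => x ^ (d + 1 + (δ : ℕ))) t (γ k) (γ k + d + 1)

/-- The complete homogeneous symmetric sum of degree `k` in the entries of `x`. -/
def completeHomog {m : ℕ} (x : Fin m → ℝ) (k : ℕ) : ℝ :=
  ∑ α ∈ Finset.Nat.antidiagonalTuple m k, ∏ ρ, x ρ ^ α ρ

@[simp]
theorem completeHomog_zero {m : ℕ} (x : Fin m → ℝ) : completeHomog x 0 = 1 := by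
  simp [completeHomog, Finset.Nat.antidiagonalTuple_zero_right]

theorem completeHomog_fin_zero_succ (x : Fin 0 → ℝ) (k : ℕ) : completeHomog x (k + 1) = 0 := by
  simp [completeHomog]

theorem completeHomog_fin_one (x : Fin 1 → ℝ) (k : ℕ) : completeHomog x k = x 0 ^ k := by
  simp [completeHomog]

theorem completeHomog_eq_sum_antidiagonal {m : ℕ} (x : Fin (m + 1) → ℝ) (k : ℕ) :
    completeHomog x k =
      ∑ p ∈ Finset.HasAntidiagonal.antidiagonal k, x 0 ^ p.1 * completeHomog (Fin.tail x) p.2 := by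
  simp only [completeHomog, Finset.mul_sum]
  rw [Finset.sum_sigma']
  refine Finset.sum_bij' (fun (α : Fin (m + 1) → ℕ) _ => ⟨(α 0, ∑ ρ : Fin m, α ρ.succ), Fin.tail α⟩)
    (fun q _ => Fin.cons q.1.1 q.2) ?_ ?_ ?_ ?_ ?_
  · intro α hα
    rw [Finset.Nat.mem_antidiagonalTuple, Fin.sum_univ_succ] at hα
    simpa [Finset.Nat.mem_antidiagonalTuple, Fin.tail] using hα
  · rintro ⟨⟨a, b⟩, β⟩ hq
    simp only [Finset.mem_sigma, Finset.HasAntidiagonal.mem_antidiagonal, Finset.Nat.mem_antidiagonalTuple] at hq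
    rw [Finset.Nat.mem_antidiagonalTuple, Fin.sum_cons, hq.2, hq.1]
  · intro α _
    exact Fin.cons_self_tail α
  · rintro ⟨⟨a, b⟩, β⟩ hq
    simp only [Finset.mem_sigma, Finset.HasAntidiagonal.mem_antidiagonal, Finset.Nat.mem_antidiagonalTuple] at hq
    simp [hq.2]
  · intro α _
    rw [Fin.prod_univ_succ]
    rfl

theorem completeHomog_succ {m : ℕ} (x : Fin (m + 1) → ℝ) (k : ℕ) :
    completeHomog x (k + 1) =
      completeHomog (Fin.tail x) (k + 1) + x 0 * completeHomog x k := by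
  rw [completeHomog_eq_sum_antidiagonal x (k + 1), completeHomog_eq_sum_antidiagonal x k,
    Finset.Nat.sum_antidiagonal_succ, Finset.mul_sum]
  simp only [pow_zero, one_mul, pow_succ']
  simp only [mul_assoc]

theorem completeHomog_comp_perm {m : ℕ} (x : Fin m → ℝ) (e : Equiv.Perm (Fin m)) (k : ℕ) :
    completeHomog (x ∘ e) k = completeHomog x k := by
  refine Finset.sum_equiv (e.arrowCongr (Equiv.refl ℕ)) ?_ ?_
  · intro α
    simp only [Finset.Nat.mem_antidiagonalTuple]
    rw [← Equiv.sum_comp e (e.arrowCongr (Equiv.refl ℕ) α)]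
    simp
  · intro α _
    symm
    rw [← Equiv.prod_comp e]
    simp

theorem completeHomog_succ_init {m : ℕ} (x : Fin (m + 1) → ℝ) (k : ℕ) :
    completeHomog x (k + 1) =
      completeHomog (Fin.init x) (k + 1) + x (Fin.last m) * completeHomog x k := by
  have htail : Fin.tail (x ∘ Fin.revPerm) = Fin.init x ∘ Fin.revPerm := by
    ext i
    simp [Fin.tail, Fin.init, Fin.rev_succ]
  have h := completeHomog_succ (x ∘ Fin.revPerm) k
  rw [htail] at h
  simpa [completeHomog_comp_perm] using h

theorem completeHomog_add_const {m : ℕ} (x : Fin m → ℝ) (ξ : ℝ) (k : ℕ) :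
    completeHomog (fun ρ => x ρ + ξ) k =
      ∑ β ∈ Finset.range (k + 1),
        ((k + m - 1).choose β : ℝ) * ξ ^ β * completeHomog x (k - β) := by
  induction m generalizing k with
  | zero =>
    cases k with
    | zero => simp
    | succ k =>
      rw [completeHomog_fin_zero_succ, Finset.sum_range_succ, Nat.choose_eq_zero_of_lt (by omega)]
      symm
      rw [Finset.sum_eq_zero, Nat.cast_zero]
      · ring
      · intro β hβ
        rw [Finset.mem_range] at hβ
        rw [show k + 1 - β = k - β + 1 by omega, completeHomog_fin_zero_succ, mul_zero]
  | succ m ihm =>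
    induction k with
    | zero => simp
    | succ k ihk =>
      have htail : Fin.tail (fun ρ => x ρ + ξ) = fun ρ => Fin.tail x ρ + ξ := rfl
      have hstep : ∀ β ∈ Finset.range (k + 1),
          ((k + m).choose β : ℝ) * ξ ^ β * completeHomog (Fin.tail x) (k + 1 - β) =
            ((k + m).choose β : ℝ) * ξ ^ β * completeHomog x (k + 1 - β) -
              x 0 * (((k + m).choose β : ℝ) * ξ ^ β * completeHomog x (k - β)) := by
        intro β hβ
        rw [Finset.mem_range] at hβ
        rw [Nat.succ_sub (by omega), completeHomog_succ x]
        ring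
      have hpascal : ∀ β ∈ Finset.range (k + 1),
          ((k + 1 + m).choose (β + 1) : ℝ) * ξ ^ (β + 1) * completeHomog x (k + 1 - (β + 1)) =
            ξ * (((k + m).choose β : ℝ) * ξ ^ β * completeHomog x (k - β)) +
              ((k + m).choose (β + 1) : ℝ) * ξ ^ (β + 1) * completeHomog x (k + 1 - (β + 1)) := by
        intro β _
        rw [Nat.add_right_comm, Nat.choose_succ_succ, Nat.add_sub_add_right]
        push_cast
        ring
      have hsplit : ∀ f : ℕ → ℝ,
          ∑ β ∈ Finset.range (k + 1), f (β + 1) =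
            ∑ β ∈ Finset.range (k + 1), f β + f (k + 1) - f 0 := by
        intro f
        rw [← Finset.sum_range_succ, Finset.sum_range_succ' f (k + 1)]
        ring
      rw [completeHomog_succ, htail, ihm, ihk, Finset.sum_range_succ,
        show k + 1 + m - 1 = k + m by omega, show k + (m + 1) - 1 = k + m by omega,
        show k + 1 + (m + 1) - 1 = k + 1 + m by omega, Finset.sum_congr rfl hstep,
        Finset.sum_range_succ' _ (k + 1), Finset.sum_congr rfl hpascal,
        Finset.sum_add_distrib, Finset.sum_sub_distrib, ← Finset.mul_sum, ← Finset.mul_sum,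
        hsplit fun β => ((k + m).choose β : ℝ) * ξ ^ β * completeHomog x (k + 1 - β)]
      simp
      ring

theorem completeHomog_const (m : ℕ) (c : ℝ) (k : ℕ) :
    completeHomog (fun _ : Fin (m + 1) => c) k = ((k + m).choose k : ℝ) * c ^ k := by
  induction m generalizing k with
  | zero => simp [completeHomog_fin_one]
  | succ m ihm =>
    induction k with
    | zero => simp
    | succ k ihk =>
      have htail : Fin.tail (fun _ : Fin (m + 2) => c) = fun _ => c := rfl
      rw [completeHomog_succ, htail, ihm, ihk, show k + 1 + (m + 1) = k + (m + 1) + 1 by omega,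
        Nat.choose_succ_succ, show k + 1 + m = k + (m + 1) by omega]
      push_cast
      ring

/-- Steffensen's formula: the divided difference of a monomial is a complete homogeneous sum. -/
theorem divDiff_pow (t : ℕ → ℝ) (m k i : ℕ)
    (ht : ∀ a b, i ≤ a → a ≤ b → b ≤ i + m → t a ≤ t b) :
    divDiff (fun x => x ^ (m + k)) t i (i + m) =
      completeHomog (fun ρ : Fin (m + 1) => t (i + ρ)) k := by
  induction m generalizing k i with
  | zero =>
    rw [divDiff]
    simp [completeHomog_fin_one]
  | succ m ih =>
    rw [divDiff, dif_neg (by omega)]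
    split_ifs with heq
    · have hconst : (fun ρ : Fin (m + 1 + 1) => t (i + ρ)) = fun _ => t i := by
        ext ρ
        refine le_antisymm ?_ (ht _ _ le_rfl (by omega) (by omega))
        rw [heq]
        exact ht _ _ (by omega) (by omega) le_rfl
      rw [hconst, completeHomog_const, iteratedDeriv_pow, Nat.add_sub_cancel_left,
        Nat.add_sub_cancel_left, Nat.descFactorial_eq_factorial_mul_choose, Nat.choose_symm_add,
        Nat.add_comm k]
      have := Nat.cast_ne_zero (R := ℝ).mpr (Nat.factorial_ne_zero (m + 1))
      push_cast
      field_simp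
    · have hright := ih (k + 1) (i + 1) fun a b ha hab hb => ht a b (by omega) hab (by omega)
      have hleft := ih (k + 1) i fun a b ha hab hb => ht a b ha hab (by omega)
      have htail := completeHomog_succ (fun ρ : Fin (m + 1 + 1) => t (i + ρ)) k
      have hinit := completeHomog_succ_init (fun ρ : Fin (m + 1 + 1) => t (i + ρ)) k
      have htail_eq : Fin.tail (fun ρ : Fin (m + 1 + 1) => t (i + ρ)) =
          fun ρ : Fin (m + 1) => t (i + 1 + ρ) := by
        ext ρ
        simp [Fin.tail, Nat.add_assoc, Nat.add_comm 1]
      have hinit_eq : Fin.init (fun ρ : Fin (m + 1 + 1) => t (i + ρ)) =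
          fun ρ : Fin (m + 1) => t (i + ρ) := rfl
      rw [show m + 1 + k = m + (k + 1) by omega, show i + (m + 1) - 1 = i + m by omega, hleft,
        show i + (m + 1) = i + 1 + m by omega, hright, div_eq_iff]
      · rw [htail_eq] at htail
        rw [hinit_eq, htail] at hinit
        simp only [Fin.val_zero, Fin.val_last, Nat.add_zero,
          show i + (m + 1) = i + 1 + m by omega] at hinit
        linear_combination hinit
      · rw [show i + 1 + m = i + (m + 1) by omega]
        exact sub_ne_zero.mpr (Ne.symm heq)

theorem reproMatrix_apply (d n : ℕ) (γ : Fin (n + 1) → ℕ) (hγ : StrictMono γ) (t : ℕ → ℝ)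
    (ht : ∀ i j : ℕ, i ≤ j → j ≤ γ (Fin.last n) + d + 1 → t i ≤ t j) (δ k : Fin (n + 1)) :
    reproMatrix d n γ t δ k = completeHomog (fun ρ : Fin (d + 2) => t (γ k + ρ)) δ := by
  refine divDiff_pow t (d + 1) δ (γ k) fun a b _ hab hb => ht a b hab ?_
  have := hγ.monotone (Fin.le_last k)
  omega

/-- **reproduction matrix for shifted knots.** For all knots,
`Σ_{|α|=δ} Π_ρ (t_{j+ρ} + ξ)^{α_ρ}
  = Σ_{β=0}^{δ} binom(δ+d+1, β) ξ^β Σ_{|a|=δ−β} Π_ρ t_{j+ρ}^{a_ρ}`;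
consequently `M_ξ = P_{d,n}(ξ) · M`, where `M_ξ` is the reproduction matrix of the shifted
knots `t + ξ`, `M = M_{0,t,γ}`, and `P_{d,n}(ξ)` is lower triangular with entries
`binom(δ+d+1, δ−β) ξ^{δ−β}`. -/
theorem reproMatrix_shifted (d n : ℕ) (γ : Fin (n + 1) → ℕ)
    (hγ : StrictMono γ) (hγ0 : γ 0 = 0)
    (t : ℕ → ℝ)
    (hmono : ∀ i j : ℕ, i ≤ j → j ≤ γ (Fin.last n) + d + 1 → t i ≤ t j)
    (ξ : ℝ) :
    (∀ (j δ : ℕ), δ ≤ n →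
      (∑ α ∈ Finset.Nat.antidiagonalTuple (d + 2) δ,
          ∏ ρ : Fin (d + 2), (t (j + (ρ : ℕ)) + ξ) ^ (α ρ))
        = ∑ β ∈ Finset.range (δ + 1), ((δ + d + 1).choose β : ℝ) * ξ ^ β *
            ∑ a ∈ Finset.Nat.antidiagonalTuple (d + 2) (δ - β),
              ∏ ρ : Fin (d + 2), (t (j + (ρ : ℕ))) ^ (a ρ))
    ∧ reproMatrix d n γ (fun i => t i + ξ)
        = (Matrix.of fun δ β : Fin (n + 1) =>
            if (β : ℕ) ≤ (δ : ℕ) then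
              (((δ : ℕ) + d + 1).choose ((δ : ℕ) - (β : ℕ)) : ℝ) * ξ ^ ((δ : ℕ) - (β : ℕ))
            else 0)
          * reproMatrix d n γ t := by
  refine ⟨fun j δ _ => completeHomog_add_const (fun ρ : Fin (d + 2) => t (j + ρ)) ξ δ, ?_⟩
  ext δ k
  rw [reproMatrix_apply d n γ hγ _ fun i j hij hj => add_le_add_left (hmono i j hij hj) ξ,
    completeHomog_add_const, Matrix.mul_apply]
  simp only [reproMatrix_apply d n γ hγ t hmono, Matrix.of_apply, ite_mul, zero_mul]
  rw [Fin.sum_univ_eq_sum_range (fun β => if β ≤ (δ : ℕ) then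
      (((δ : ℕ) + d + 1).choose (δ - β) : ℝ) * ξ ^ ((δ : ℕ) - β) *
        completeHomog (fun ρ : Fin (d + 2) => t (γ k + ρ)) β else 0) (n + 1),
    ← Finset.sum_filter, ← Finset.sum_range_reflect]
  refine Finset.sum_congr ?_ ?_
  · ext β
    simp only [Finset.mem_filter, Finset.mem_range]
    omega
  · intro β hβ
    simp only [Finset.mem_filter, Finset.mem_range] at hβ
    rw [show (δ : ℕ) + 1 - 1 - β = δ - β by omega, show (δ : ℕ) - (δ - β) = β by omega]
    rfl
end

section
/- Let d ≥ 0, n ≥ 0, let γ = (j_0, …, j_n) be a strictly increasing integer sequence with j_0 = 0, T := j_n + d + 1, let t_{0:T} be a nondecreasing real knot sequence, h > 0 and ξ ∈ ℝ. Let c_ξ ∈ ℝ^{n+1} be the first column of the inverse of the reproduction matrix associated with the scaled and shifted knot sequence h·t_{0:T} + ξ. Then c_ξ = M_{0,t,γ}^{-1} · diag(((−1)^ℓ binom(ℓ+d+1, ℓ))_{ℓ=0,…,n}) · diag((h^{−ℓ})_{ℓ=0,…,n}) · (ξ^0, ξ^1, …, ξ^n)ᵗ. In particular, each coefficient c_{ξ,ℓ}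 is a polynomial of degree at most n in ξ (not merely a rational function). -/
open Matrix

@[simp]
theorem divDiff_self (g : ℝ → ℝ) (t : ℕ → ℝ) (i : ℕ) : divDiff g t i i = g (t i) := by
  rw [divDiff]; simp

theorem divDiff_of_eq (g : ℝ → ℝ) {t : ℕ → ℝ} {i k : ℕ} (h : t i = t (i + k)) :
    divDiff g t i (i + k) = iteratedDeriv k g (t i) / k.factorial := by
  rcases Nat.eq_zero_or_pos k with rfl | hk
  · simp
  · rw [divDiff, dif_neg (by omega), if_pos h, Nat.add_sub_cancel_left]

theorem divDiff_of_ne (g : ℝ → ℝ) {t : ℕ → ℝ} {i k : ℕ} (h : t i ≠ t (i + (k + 1))) :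
    divDiff g t i (i + (k + 1)) =
      (divDiff g t (i + 1) (i + 1 + k) - divDiff g t i (i + k)) / (t (i + (k + 1)) - t i) := by
  rw [divDiff, dif_neg (by omega), if_neg h, show i + (k + 1) - 1 = i + k by omega,
    show i + 1 + k = i + (k + 1) by omega]

theorem divDiff_finset_sum {ι : Type*} (s : Finset ι) (a : ι → ℝ) (f : ι → ℝ → ℝ)
    (hf : ∀ m ∈ s, ContDiff ℝ ⊤ (f m)) (t : ℕ → ℝ) (i k : ℕ) :
    divDiff (fun x => ∑ m ∈ s, a m * f m x) t i (i + k) =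
      ∑ m ∈ s, a m * divDiff (f m) t i (i + k) := by
  induction k generalizing i with
  | zero => simp
  | succ k ih =>
    by_cases h : t i = t (i + (k + 1))
    · simp only [divDiff_of_eq _ h]
      rw [iteratedDeriv_fun_sum fun m hm =>
        (contDiff_const.mul ((hf m hm).of_le le_top)).contDiffAt, Finset.sum_div]
      exact Finset.sum_congr rfl fun m _ => by rw [iteratedDeriv_const_mul_field, mul_div_assoc]
    · simp only [divDiff_of_ne _ h, ih]
      rw [← Finset.sum_sub_distrib, Finset.sum_div]
      exact Finset.sum_congr rfl fun m _ => by ring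

/-- Divided differences over affinely transformed knots. -/
theorem divDiff_affine {g : ℝ → ℝ} (hg : ContDiff ℝ ⊤ g) {h : ℝ} (hh : h ≠ 0) (ξ : ℝ)
    (t : ℕ → ℝ) (i k : ℕ) :
    h ^ k * divDiff g (fun m => h * t m + ξ) i (i + k) =
      divDiff (fun x => g (h * x + ξ)) t i (i + k) := by
  induction k generalizing i with
  | zero => simp
  | succ k ih =>
    by_cases e : t i = t (i + (k + 1))
    · rw [divDiff_of_eq _ e, divDiff_of_eq (t := fun m => h * t m + ξ) _ (by simp only [← e])]
      have hs : ContDiff ℝ (k + 1 : ℕ) fun x => g (x + ξ) :=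
        (hg.comp (contDiff_id.add contDiff_const)).of_le le_top
      rw [iteratedDeriv_comp_const_mul hs h, iteratedDeriv_comp_add_const]
      ring
    · have hne : t (i + (k + 1)) - t i ≠ 0 := sub_ne_zero.mpr (Ne.symm e)
      have e' : h * t i + ξ ≠ h * t (i + (k + 1)) + ξ := by simpa [hh] using e
      rw [divDiff_of_ne _ e, divDiff_of_ne (t := fun m => h * t m + ξ) _ e', ← ih, ← ih,
        show h * t (i + (k + 1)) + ξ - (h * t i + ξ) = h * (t (i + (k + 1)) - t i) by ring]
      field_simp
      ring

theorem MonotoneOn.eq_left_of_eq {t : ℕ → ℝ} {N : ℕ} (ht : MonotoneOn t (Set.Iic N))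
    {i j m : ℕ} (hj : j ≤ N) (h : t i = t j) (him : i ≤ m) (hmj : m ≤ j) : t m = t i :=
  le_antisymm (h ▸ ht (hmj.trans hj) hj hmj) (ht (him.trans (hmj.trans hj)) (hmj.trans hj) him)

theorem divDiff_sub_divDiff (g : ℝ → ℝ) {t : ℕ → ℝ} {N : ℕ} (ht : MonotoneOn t (Set.Iic N))
    {i k : ℕ} (hN : i + (k + 1) ≤ N) :
    divDiff g t (i + 1) (i + 1 + k) - divDiff g t i (i + k) =
      (t (i + (k + 1)) - t i) * divDiff g t i (i + (k + 1)) := by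
  by_cases h : t i = t (i + (k + 1))
  · have h1 : t (i + 1) = t i := ht.eq_left_of_eq hN h (by omega) (by omega)
    have h2 : t (i + k) = t i := ht.eq_left_of_eq hN h (by omega) (by omega)
    have h3 : t (i + 1 + k) = t i := ht.eq_left_of_eq hN h (by omega) (by omega)
    rw [divDiff_of_eq g (h1.trans h3.symm), divDiff_of_eq g h2.symm, h1, ← h]
    simp
  · rw [divDiff_of_ne g h, mul_div_cancel₀ _ (sub_ne_zero.mpr (Ne.symm h))]

theorem iteratedDeriv_pow_div_factorial (m k : ℕ) (x : ℝ) :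
    iteratedDeriv k (fun y : ℝ => y ^ m) x / k.factorial = m.choose k * x ^ (m - k) := by
  rw [iteratedDeriv_pow, Nat.descFactorial_eq_factorial_mul_choose]
  have : (k.factorial : ℝ) ≠ 0 := by positivity
  push_cast
  field_simp

/-- Leibniz rule for divided differences of `x * x ^ m`. -/
theorem divDiff_pow_succ {t : ℕ → ℝ} {N : ℕ} (ht : MonotoneOn t (Set.Iic N)) (m : ℕ)
    {i k : ℕ} (hN : i + (k + 1) ≤ N) :
    divDiff (fun x => x ^ (m + 1)) t i (i + (k + 1)) =
      t i * divDiff (fun x => x ^ m) t i (i + (k + 1)) +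
        divDiff (fun x => x ^ m) t (i + 1) (i + 1 + k) := by
  induction k generalizing i with
  | zero =>
    have hs := divDiff_sub_divDiff (fun x => x ^ m) ht hN
    by_cases h : t i = t (i + (0 + 1))
    · rw [divDiff_of_eq _ h, divDiff_of_eq _ h]
      simp only [iteratedDeriv_pow_div_factorial, add_zero, divDiff_self]
      rw [← show t i = t (i + 1) from h]
      cases m <;> simp [pow_succ]
      ring
    · have hne : t (i + 1) - t i ≠ 0 := sub_ne_zero.mpr (Ne.symm h)
      rw [divDiff_of_ne _ h, divDiff_of_ne _ h]
      simp only [zero_add, add_zero, divDiff_self]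
      field_simp
      ring
  | succ k ih =>
    by_cases h : t i = t (i + (k + 1 + 1))
    · have h1 : t (i + 1) = t i := ht.eq_left_of_eq hN h (by omega) (by omega)
      have h3 : t (i + 1 + (k + 1)) = t i := ht.eq_left_of_eq hN h (by omega) (by omega)
      rw [divDiff_of_eq _ h, divDiff_of_eq _ h, divDiff_of_eq _ (h1.trans h3.symm), h1]
      simp only [iteratedDeriv_pow_div_factorial, Nat.choose_succ_succ m (k + 1),
        Nat.add_sub_add_right]
      rcases lt_or_ge m (k + 1 + 1) with hm | hm
      · simp [Nat.choose_eq_zero_of_lt hm]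
      · obtain ⟨r, rfl⟩ := Nat.exists_eq_add_of_le hm
        rw [show k + 1 + 1 + r - (k + 1) = r + 1 by omega, Nat.add_sub_cancel_left]
        push_cast
        ring
    · have hne : t (i + (k + 1 + 1)) - t i ≠ 0 := sub_ne_zero.mpr (Ne.symm h)
      have hs := divDiff_sub_divDiff (fun x => x ^ m) ht (i := i + 1) (k := k) (by omega)
      rw [divDiff_of_ne _ h, divDiff_of_ne _ h, ih (by omega), ih (by omega)]
      rw [show i + 1 + (k + 1) = i + (k + 1 + 1) by omega] at *
      field_simp
      linear_combination hs

theorem divDiff_pow_eq_zero {t : ℕ → ℝ} {N : ℕ} (ht : MonotoneOn t (Set.Iic N)) {m i k : ℕ}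
    (hm : m < k) (hN : i + k ≤ N) : divDiff (fun x => x ^ m) t i (i + k) = 0 := by
  induction m generalizing i k with
  | zero =>
    induction k generalizing i with
    | zero => omega
    | succ k ih =>
      by_cases h : t i = t (i + (k + 1))
      · rw [divDiff_of_eq _ h, iteratedDeriv_pow_div_factorial]
        simp
      · rw [divDiff_of_ne _ h]
        rcases Nat.eq_zero_or_pos k with rfl | hk
        · simp
        · rw [ih hk (by omega), ih hk (by omega)]
          simp
  | succ m ih =>
    obtain ⟨k, rfl⟩ : ∃ l, k = l + 1 := ⟨k - 1, by omega⟩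
    rw [divDiff_pow_succ ht m hN, ih (by omega) hN, ih (by omega) (by omega)]
    simp

/-- The lower triangular matrix relating the reproduction matrices of `t` and `h * t + ξ`. -/
noncomputable def affineShiftMatrix (d n : ℕ) (h ξ : ℝ) :
    Matrix (Fin (n + 1)) (Fin (n + 1)) ℝ :=
  Matrix.of fun δ i =>
    ((d + 1 + (δ : ℕ)).choose (d + 1 + (i : ℕ)) : ℝ) * h ^ (i : ℕ) * ξ ^ ((δ : ℕ) - (i : ℕ))

theorem isUnit_det_affineShiftMatrix (d n : ℕ) {h : ℝ} (hh : h ≠ 0) (ξ : ℝ) :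
    IsUnit (affineShiftMatrix d n h ξ).det := by
  rw [Matrix.det_of_isLowerTriangular]
  · simp [affineShiftMatrix, isUnit_iff_ne_zero, Finset.prod_ne_zero_iff, hh]
  · intro i j hij
    have : (i : ℕ) < j := hij
    simp [affineShiftMatrix, Nat.choose_eq_zero_of_lt, this]

theorem reproMatrix_affine (d n : ℕ) (γ : Fin (n + 1) → ℕ) (hγ : Monotone γ) {t : ℕ → ℝ}
    (ht : MonotoneOn t (Set.Iic (γ (Fin.last n) + d + 1))) {h : ℝ} (hh : h ≠ 0) (ξ : ℝ) :
    reproMatrix d n γ (fun i => h * t i + ξ) =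
      affineShiftMatrix d n h ξ * reproMatrix d n γ t := by
  ext δ k
  have hk : γ k + (d + 1) ≤ γ (Fin.last n) + d + 1 := by
    have := hγ (Fin.le_last k)
    omega
  have hexp : (fun x => (h * x + ξ) ^ (d + 1 + (δ : ℕ))) = fun x =>
      ∑ m ∈ Finset.range (d + 1 + (n + 1)),
        (((d + 1 + (δ : ℕ)).choose m : ℝ) * h ^ m * ξ ^ (d + 1 + (δ : ℕ) - m)) * x ^ m := by
    funext x
    rw [add_pow]
    refine Finset.sum_subset_zero_on_sdiff ?_ ?_ ?_
    · exact Finset.range_mono (by omega)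
    · intro m hm
      rw [Finset.mem_sdiff, Finset.mem_range, Finset.mem_range] at hm
      rw [Nat.choose_eq_zero_of_lt (by omega)]
      simp
    · intro m _
      rw [mul_pow]
      ring
  have haff := divDiff_affine (g := fun x => x ^ (d + 1 + (δ : ℕ))) (contDiff_id.pow _) hh ξ t
    (γ k) (d + 1)
  rw [hexp, divDiff_finset_sum _ _ (fun m x => x ^ m) fun m _ => contDiff_id.pow m,
    Finset.sum_range_add, Finset.sum_eq_zero, zero_add, Finset.sum_range] at haff
  · rw [Matrix.mul_apply]
    refine mul_left_cancel₀ (pow_ne_zero (d + 1) hh) (haff.trans ?_)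
    rw [Finset.mul_sum]
    refine Finset.sum_congr rfl fun i _ => ?_
    simp only [affineShiftMatrix, reproMatrix, Matrix.of_apply, Nat.add_sub_add_left, ← add_assoc]
    ring
  · intro m hm
    rw [divDiff_pow_eq_zero ht (Finset.mem_range.mp hm) hk, mul_zero]

theorem affineShiftMatrix_mulVec (d n : ℕ) {h : ℝ} (hh : h ≠ 0) (ξ : ℝ) :
    affineShiftMatrix d n h ξ *ᵥ (fun ℓ : Fin (n + 1) =>
      (-1 : ℝ) ^ (ℓ : ℕ) * (((ℓ : ℕ) + d + 1).choose (ℓ : ℕ) : ℝ) *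
        ((h ^ (ℓ : ℕ))⁻¹ * ξ ^ (ℓ : ℕ))) = Pi.single 0 1 := by
  ext δ
  have hterm : ∀ i : ℕ, ((d + 1 + (δ : ℕ)).choose (d + 1 + i) : ℝ) * h ^ i * ξ ^ ((δ : ℕ) - i) *
      ((-1 : ℝ) ^ i * ((i + d + 1).choose i : ℝ) * ((h ^ i)⁻¹ * ξ ^ i)) =
      ((d + 1 + (δ : ℕ)).choose (d + 1) : ℝ) * ξ ^ (δ : ℕ) *
        ((-1) ^ i * ((δ : ℕ).choose i : ℝ)) := by
    intro i
    have hc := Nat.choose_mul (n := d + 1 + (δ : ℕ)) (k := d + 1 + i) (s := d + 1) (by omega)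
    rw [Nat.add_sub_cancel_left, Nat.add_sub_cancel_left] at hc
    rw [show (i + d + 1).choose i = (d + 1 + i).choose (d + 1) by
      rw [show i + d + 1 = d + 1 + i by omega, Nat.choose_symm_add]]
    have hc' : ((d + 1 + (δ : ℕ)).choose (d + 1 + i) : ℝ) * ((d + 1 + i).choose (d + 1) : ℝ) =
      ((d + 1 + (δ : ℕ)).choose (d + 1) : ℝ) * ((δ : ℕ).choose i : ℝ) := by exact_mod_cast hc
    rcases lt_or_ge (δ : ℕ) i with hi | hi
    · simp [Nat.choose_eq_zero_of_lt hi,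
        Nat.choose_eq_zero_of_lt (show d + 1 + δ < d + 1 + i by omega)]
    · have hp : ξ ^ ((δ : ℕ) - i) * ξ ^ i = ξ ^ (δ : ℕ) := pow_sub_mul_pow ξ hi
      have hhi : h ^ i * (h ^ i)⁻¹ = 1 := mul_inv_cancel₀ (pow_ne_zero i hh)
      calc _ = (((d + 1 + (δ : ℕ)).choose (d + 1 + i) : ℝ) * ((d + 1 + i).choose (d + 1) : ℝ)) *
            (ξ ^ ((δ : ℕ) - i) * ξ ^ i) * (h ^ i * (h ^ i)⁻¹) * (-1) ^ i := by ring
        _ = _ := by rw [hc', hp, hhi]; ring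
  simp only [Matrix.mulVec, dotProduct, affineShiftMatrix, Matrix.of_apply, hterm]
  rw [← Finset.mul_sum, ← Finset.sum_range fun i => (-1 : ℝ) ^ i * ((δ : ℕ).choose i : ℝ),
    ← Finset.sum_subset (Finset.range_mono (show (δ : ℕ) + 1 ≤ n + 1 by omega))]
  · have halt := congrArg (Int.cast : ℤ → ℝ) (Int.alternating_sum_range_choose (n := (δ : ℕ)))
    push_cast at halt
    rw [halt]
    rcases eq_or_ne δ 0 with rfl | hδ
    · simp
    · simp [hδ]
  · intro m _ hm
    rw [Finset.mem_range, not_lt] at hm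
    rw [Nat.choose_eq_zero_of_lt (by omega)]
    simp

theorem reproMatrix_affine_inv_col (d n : ℕ) (γ : Fin (n + 1) → ℕ) (hγ : Monotone γ) {t : ℕ → ℝ}
    (ht : MonotoneOn t (Set.Iic (γ (Fin.last n) + d + 1))) {h : ℝ} (hh : h ≠ 0) (ξ : ℝ) :
    (fun ℓ => (reproMatrix d n γ (fun i => h * t i + ξ))⁻¹ ℓ 0) =
      ((reproMatrix d n γ t)⁻¹
          * Matrix.diagonal (fun ℓ : Fin (n + 1) =>
              (-1 : ℝ) ^ (ℓ : ℕ) * (((ℓ : ℕ) + d + 1).choose (ℓ : ℕ) : ℝ))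
          * Matrix.diagonal (fun ℓ : Fin (n + 1) => (h ^ (ℓ : ℕ))⁻¹))
        *ᵥ (fun ℓ : Fin (n + 1) => ξ ^ (ℓ : ℕ)) := by
  have hdiag : ∀ u v : Fin (n + 1) → ℝ, Matrix.diagonal u *ᵥ v = fun ℓ => u ℓ * v ℓ :=
    fun u v => funext fun ℓ => Matrix.mulVec_diagonal u v ℓ
  calc _ = (reproMatrix d n γ (fun i => h * t i + ξ))⁻¹ *ᵥ Pi.single 0 1 := by
        rw [Matrix.mulVec_single_one]; rfl
    _ = _ := by
      rw [reproMatrix_affine d n γ hγ ht hh ξ, Matrix.mul_inv_rev,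
        ← affineShiftMatrix_mulVec d n hh ξ,
        Matrix.mulVec_mulVec, Matrix.mul_assoc,
        Matrix.nonsing_inv_mul _ (isUnit_det_affineShiftMatrix d n hh ξ), Matrix.mul_one,
        ← Matrix.mulVec_mulVec, ← Matrix.mulVec_mulVec, hdiag, hdiag]

/-- **scaled and shifted SIAC coefficients.** The first column `c_ξ` of the
inverse reproduction matrix for the knots `h·t + ξ` satisfies
`c_ξ = M_{0,t,γ}⁻¹ · diag((−1)^ℓ binom(ℓ+d+1,ℓ)) · diag(h^{−ℓ}) · (ξ^0, …, ξ^n)ᵗ`;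
in particular each coefficient `c_{ξ,ℓ}` is a polynomial of degree at most `n` in `ξ`. -/
theorem siac_coeffs_scaled_shifted (d n : ℕ) (γ : Fin (n + 1) → ℕ)
    (hγ : StrictMono γ) (hγ0 : γ 0 = 0)
    (t : ℕ → ℝ)
    (hmono : ∀ i j : ℕ, i ≤ j → j ≤ γ (Fin.last n) + d + 1 → t i ≤ t j)
    (h : ℝ) (hh : 0 < h) (ξ : ℝ)
    (c : Fin (n + 1) → ℝ)
    (hc : c = fun ℓ => (reproMatrix d n γ (fun i => h * t i + ξ))⁻¹ ℓ 0) :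
    c = ((reproMatrix d n γ t)⁻¹
          * Matrix.diagonal (fun ℓ : Fin (n + 1) =>
              (-1 : ℝ) ^ (ℓ : ℕ) * (((ℓ : ℕ) + d + 1).choose (ℓ : ℕ) : ℝ))
          * Matrix.diagonal (fun ℓ : Fin (n + 1) => (h ^ (ℓ : ℕ))⁻¹))
        *ᵥ (fun ℓ : Fin (n + 1) => ξ ^ (ℓ : ℕ))
    ∧ ∀ ℓ : Fin (n + 1), ∃ p : Polynomial ℝ, p.natDegree ≤ n ∧
        ∀ ξ' : ℝ, (reproMatrix d n γ (fun i => h * t i + ξ'))⁻¹ ℓ 0 = p.eval ξ' := by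
  have ht : MonotoneOn t (Set.Iic (γ (Fin.last n) + d + 1)) :=
    fun i _ j hj hij => hmono i j hij hj
  have hcol := reproMatrix_affine_inv_col d n γ hγ.monotone ht hh.ne'
  refine ⟨hc.trans (hcol ξ), fun ℓ => ?_⟩
  refine ⟨∑ i : Fin (n + 1), Polynomial.C (((reproMatrix d n γ t)⁻¹
    * Matrix.diagonal (fun ℓ : Fin (n + 1) =>
        (-1 : ℝ) ^ (ℓ : ℕ) * (((ℓ : ℕ) + d + 1).choose (ℓ : ℕ) : ℝ))
    * Matrix.diagonal (fun ℓ : Fin (n + 1) => (h ^ (ℓ : ℕ))⁻¹)) ℓ i) * Polynomial.X ^ (i : ℕ),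
    Polynomial.natDegree_sum_le_of_forall_le _ _ fun i _ =>
      (Polynomial.natDegree_C_mul_X_pow_le _ _).trans (by omega), fun ξ' => ?_⟩
  rw [congrFun (hcol ξ') ℓ, Polynomial.eval_finsetSum]
  simp only [Polynomial.eval_mul, Polynomial.eval_C, Polynomial.eval_pow, Polynomial.eval_X]
  rfl
end
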